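/- Let R be an integral domain and Ê a w-universal injective R-module. A GV-torsion-free R-module M is pure w-injective if and only if M is a direct summand of an R-module of the form Hom_R(L, Ê) for some R-module L. -/

import Mathlib

open TensorProduct

/-- A finitely generated ideal `J` is a GV-ideal if the natural map
`R → Hom_R(J, R)`, sending `r` to multiplication by `r`, is bijective. -/
def IsGVIdeal {R : Type*} [CommRing R] (J : Ideal R) : Prop :=
  J.FG ∧ Function.Bijective fun r : R => (r • J.subtype : J →ₗ[R] R)

/-- An element `m` of an `R`-module is a GV-torsion element if it is
annihilated by some GV-ideal. -/
def IsGVTorsionElem (R : Type*) [CommRing R] {M : Type*} [AddCommGroup M] [Module R M]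
    (m : M) : Prop :=
  ∃ J : Ideal R, IsGVIdeal J ∧ ∀ j ∈ J, j • m = 0

/-- An `R`-module `E` is `w`-universal injective if `E` is injective, GV-torsion-free,
and for every GV-torsion-free module `A` and nonzero `x ∈ A` there is `f : A → E`
with `f x ≠ 0`. -/
def IsWUniversalInjective (R : Type u) [CommRing R] (E : Type u) [AddCommGroup E]
    [Module R E] : Prop :=
  Module.Injective R E ∧ (∀ e : E, IsGVTorsionElem R e → e = 0) ∧
  ∀ (A : Type u) [AddCommGroup A] [Module R A],
    (∀ a : A, IsGVTorsionElem R a → a = 0) →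
    ∀ x : A, x ≠ 0 → ∃ f : A →ₗ[R] E, f x ≠ 0

/-- An `R`-module `E` is pure `w`-injective if it is injective with respect to all
`w`-pure `w`-monomorphisms. -/
def IsPureWInjective (R : Type u) [CommRing R] (E : Type u) [AddCommGroup E]
    [Module R E] : Prop :=
  ∀ (N M : Type u) [AddCommGroup N] [Module R N] [AddCommGroup M] [Module R M]
    (f : N →ₗ[R] M),
    (∀ x ∈ LinearMap.ker f, IsGVTorsionElem R x) →
    (∀ (L : Type u) [AddCommGroup L] [Module R L],
      ∀ x ∈ LinearMap.ker (LinearMap.lTensor L f), IsGVTorsionElem R x) →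
    ∀ g : N →ₗ[R] E, ∃ h : M →ₗ[R] E, h ∘ₗ f = g

/-- The product of two GV-ideals is a GV-ideal. -/
theorem IsGVIdeal.mul {R : Type*} [CommRing R] {I J : Ideal R}
    (hI : IsGVIdeal I) (hJ : IsGVIdeal J) : IsGVIdeal (I * J) := by
  refine ⟨Submodule.FG.mul hI.1 hJ.1, ?_, ?_⟩
  · intro r s hrs
    apply hI.2.1
    ext ⟨a, ha⟩
    have hab : r * a = s * a := by
      apply hJ.2.1
      ext ⟨b, hb⟩
      have h := LinearMap.congr_fun hrs ⟨a * b, Ideal.mul_mem_mul ha hb⟩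
      simpa [mul_assoc] using h
    simpa using hab
  · intro f
    let e : R ≃ₗ[R] (J →ₗ[R] R) :=
      LinearEquiv.ofBijective (LinearMap.toSpanSingleton R _ J.subtype) hJ.2
    let c : I →ₗ[R] (J →ₗ[R] R) := LinearMap.mk₂ R
      (fun a b => f ⟨a * b, Ideal.mul_mem_mul a.2 b.2⟩)
      (fun a a' b => by rw [← map_add]; congr 1; ext; simp [add_mul])
      (fun r a b => by rw [← map_smul]; congr 1; ext; simp [mul_assoc])
      (fun a b b' => by rw [← map_add]; congr 1; ext; simp [mul_add])
      (fun r a b => by rw [← map_smul]; congr 1; ext; simp [mul_left_comm])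
    obtain ⟨s, hs⟩ := hI.2.2 (e.symm.toLinearMap ∘ₗ c)
    have key (a : I) (b : J) : s * (a * b) = f ⟨a * b, Ideal.mul_mem_mul a.2 b.2⟩ := by
      have h₁ : s * (a : R) = e.symm (c a) := LinearMap.congr_fun hs a
      have h₂ : e (s * (a : R)) = c a := by rw [h₁, e.apply_symm_apply]
      have h₃ : s * (a : R) * (b : R) = c a b := LinearMap.congr_fun h₂ b
      rw [← mul_assoc, h₃]
      rfl
    refine ⟨s, ?_⟩
    ext ⟨x, hx⟩
    change s * x = f ⟨x, hx⟩
    induction hx using Submodule.mul_induction_on' with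
    | mem_mul_mem a ha b hb => exact key ⟨a, ha⟩ ⟨b, hb⟩
    | add x hx y hy ihx ihy =>
      rw [mul_add, ihx, ihy, ← map_add]
      rfl

/-- The unit ideal is a GV-ideal. -/
theorem isGVIdeal_top (R : Type*) [CommRing R] : IsGVIdeal (⊤ : Ideal R) := by
  refine ⟨Module.Finite.fg_top, ?_, ?_⟩
  · intro r s hrs
    simpa using LinearMap.congr_fun hrs ⟨1, Submodule.mem_top⟩
  · intro f
    refine ⟨f ⟨1, Submodule.mem_top⟩, ?_⟩
    ext ⟨x, hx⟩
    have h : (⟨x, hx⟩ : (⊤ : Ideal R)) = x • ⟨1, Submodule.mem_top⟩ := by ext; simp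
    rw [h, map_smul, map_smul]
    simp

/-- The submodule of GV-torsion elements. -/
def gvTorsion (R M : Type*) [CommRing R] [AddCommGroup M] [Module R M] : Submodule R M where
  carrier := {m | IsGVTorsionElem R m}
  zero_mem' := ⟨⊤, isGVIdeal_top R, fun j _ => smul_zero j⟩
  add_mem' := by
    rintro x y ⟨I, hI, hx⟩ ⟨J, hJ, hy⟩
    refine ⟨I * J, hI.mul hJ, fun j hj => ?_⟩
    rw [smul_add, hx j (Ideal.mul_le_left hj), hy j (Ideal.mul_le_right hj), add_zero]
  smul_mem' := by
    rintro r x ⟨I, hI, hx⟩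
    exact ⟨I, hI, fun j hj => by rw [smul_comm, hx j hj, smul_zero]⟩

/-- Finitely many GV-torsion elements are annihilated by a common GV-ideal. -/
theorem exists_isGVIdeal_forall_smul_eq_zero {R M ι : Type*} [CommRing R] [AddCommGroup M]
    [Module R M] (s : Finset ι) (v : ι → M) (hv : ∀ i ∈ s, IsGVTorsionElem R (v i)) :
    ∃ J : Ideal R, IsGVIdeal J ∧ ∀ i ∈ s, ∀ j ∈ J, j • v i = 0 := by
  classical
  induction s using Finset.induction_on with
  | empty => exact ⟨⊤, isGVIdeal_top R, by simp⟩
  | insert a s _ ih =>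
    obtain ⟨J, hJ, hs⟩ := ih fun i hi => hv i (Finset.mem_insert_of_mem hi)
    obtain ⟨I, hI, ha⟩ := hv a (Finset.mem_insert_self a s)
    refine ⟨I * J, hI.mul hJ, fun i hi j hj => ?_⟩
    rcases Finset.mem_insert.mp hi with rfl | hi
    · exact ha j (Ideal.mul_le_left hj)
    · exact hs i hi j (Ideal.mul_le_right hj)

/-- An element is GV-torsion if all its multiples by a GV-ideal are. -/
theorem IsGVTorsionElem.of_forall_smul {R M : Type*} [CommRing R] [AddCommGroup M]
    [Module R M] {J : Ideal R} (hJ : IsGVIdeal J) {m : M}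
    (hm : ∀ j ∈ J, IsGVTorsionElem R (j • m)) : IsGVTorsionElem R m := by
  obtain ⟨s, rfl⟩ := hJ.1
  obtain ⟨K, hK, h⟩ := exists_isGVIdeal_forall_smul_eq_zero s (fun i => i • m)
    fun i hi => hm i (Submodule.subset_span hi)
  refine ⟨K * Submodule.span R s, hK.mul hJ, fun x hx => ?_⟩
  have hle : K * Submodule.span R s ≤ LinearMap.ker (LinearMap.toSpanSingleton R M m) := by
    refine Ideal.mul_le.mpr fun k hk j hj => ?_
    have hj' : Submodule.span R (s : Set R) ≤
        LinearMap.ker (k • LinearMap.toSpanSingleton R M m) :=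
      Submodule.span_le.mpr fun i hi => by simpa using h i hi k hk
    simpa [mul_smul] using hj' hj
  simpa using hle hx

/-- The quotient of a module by its GV-torsion submodule is GV-torsion-free. -/
theorem gvTorsion_quotient_eq_zero {R M : Type*} [CommRing R] [AddCommGroup M] [Module R M]
    (x : M ⧸ gvTorsion R M) (hx : IsGVTorsionElem R x) : x = 0 := by
  induction x using Submodule.Quotient.induction_on with
  | H m =>
    obtain ⟨J, hJ, h⟩ := hx
    refine (Submodule.Quotient.mk_eq_zero _).mpr (IsGVTorsionElem.of_forall_smul hJ fun j hj => ?_)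
    exact (Submodule.Quotient.mk_eq_zero (gvTorsion R M)).mp (h j hj)

/-- Linear maps send GV-torsion elements to GV-torsion elements. -/
theorem IsGVTorsionElem.map {R M N : Type*} [CommRing R] [AddCommGroup M] [Module R M]
    [AddCommGroup N] [Module R N] {m : M} (hm : IsGVTorsionElem R m) (f : M →ₗ[R] N) :
    IsGVTorsionElem R (f m) := by
  obtain ⟨J, hJ, h⟩ := hm
  exact ⟨J, hJ, fun j hj => by rw [← map_smul, h j hj, map_zero]⟩

/-- An element killed by every map to a `w`-universal injective module is GV-torsion. -/
theorem IsWUniversalInjective.isGVTorsionElem {R : Type u} [CommRing R]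
    {E : Type u} [AddCommGroup E] [Module R E] (hE : IsWUniversalInjective R E)
    {A : Type u} [AddCommGroup A] [Module R A] {x : A}
    (hx : ∀ f : A →ₗ[R] E, f x = 0) : IsGVTorsionElem R x := by
  by_contra hne
  obtain ⟨f, hf⟩ := hE.2.2 (A ⧸ gvTorsion R A) gvTorsion_quotient_eq_zero
    ((gvTorsion R A).mkQ x) fun h => hne ((Submodule.Quotient.mk_eq_zero _).mp h)
  exact hf (hx (f ∘ₗ (gvTorsion R A).mkQ))

/-- A map from `A` to a GV-torsion-free injective module extends along any linear map out
of `A` with GV-torsion kernel. -/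
theorem exists_comp_eq_of_ker_gvTorsion {R : Type u} [CommRing R]
    {E A B : Type u} [AddCommGroup E] [Module R E] [AddCommGroup A] [Module R A]
    [AddCommGroup B] [Module R B] (hE : Module.Injective R E)
    (hEtf : ∀ e : E, IsGVTorsionElem R e → e = 0) (f : A →ₗ[R] B)
    (hf : ∀ x ∈ LinearMap.ker f, IsGVTorsionElem R x) (g : A →ₗ[R] E) :
    ∃ h : B →ₗ[R] E, h ∘ₗ f = g := by
  have hle : LinearMap.ker f ≤ LinearMap.ker g := fun x hx => hEtf _ ((hf x hx).map g)
  obtain ⟨h, hh⟩ := hE.out ((LinearMap.ker f).liftQ f le_rfl)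
    (LinearMap.ker_eq_bot.mp (Submodule.ker_liftQ_eq_bot _ _ _ le_rfl))
    ((LinearMap.ker f).liftQ g hle)
  exact ⟨h, LinearMap.ext fun x => hh (Submodule.Quotient.mk x)⟩

/-- `Hom_R(L, E)` is pure `w`-injective for `E` injective and GV-torsion-free. -/
theorem isPureWInjective_linearMap {R : Type u} [CommRing R]
    {E : Type u} [AddCommGroup E] [Module R E] (hE : Module.Injective R E)
    (hEtf : ∀ e : E, IsGVTorsionElem R e → e = 0)
    (L : Type u) [AddCommGroup L] [Module R L] : IsPureWInjective R (L →ₗ[R] E) := by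
  intro N M _ _ _ _ f _ hpure g
  obtain ⟨h, hh⟩ := exists_comp_eq_of_ker_gvTorsion hE hEtf (LinearMap.lTensor L f) (hpure L)
    (TensorProduct.lift g.flip)
  refine ⟨(TensorProduct.curry h).flip, ?_⟩
  ext n l
  simpa using LinearMap.congr_fun hh (l ⊗ₜ n)

/-- A direct summand of a pure `w`-injective module is pure `w`-injective. -/
theorem IsPureWInjective.of_retract {R : Type u} [CommRing R]
    {E M : Type u} [AddCommGroup E] [Module R E] [AddCommGroup M] [Module R M]
    (hE : IsPureWInjective R E) (i : M →ₗ[R] E) (p : E →ₗ[R] M)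
    (hpi : p ∘ₗ i = LinearMap.id) : IsPureWInjective R M := by
  intro A B _ _ _ _ f hf hpure g
  obtain ⟨h, hh⟩ := hE A B f hf hpure (i ∘ₗ g)
  exact ⟨p ∘ₗ h, by rw [LinearMap.comp_assoc, hh, ← LinearMap.comp_assoc, hpi,
    LinearMap.id_comp]⟩

/-- The evaluation map from `M` to its double dual with respect to a `w`-universal injective
module is `w`-pure. -/
theorem IsWUniversalInjective.lTensor_eval {R : Type u} [CommRing R]
    {E : Type u} [AddCommGroup E] [Module R E] (hE : IsWUniversalInjective R E)
    (M L : Type u) [AddCommGroup M] [Module R M] [AddCommGroup L] [Module R L]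
    (x : L ⊗[R] M)
    (hx : x ∈ LinearMap.ker
      (LinearMap.lTensor L (LinearMap.id : (M →ₗ[R] E) →ₗ[R] (M →ₗ[R] E)).flip)) :
    IsGVTorsionElem R x := by
  refine hE.isGVTorsionElem fun φ => ?_
  let ψ : L ⊗[R] ((M →ₗ[R] E) →ₗ[R] E) →ₗ[R] E :=
    TensorProduct.lift (LinearMap.id.flip ∘ₗ TensorProduct.curry φ)
  have hψ : ψ ∘ₗ LinearMap.lTensor L (LinearMap.id : (M →ₗ[R] E) →ₗ[R] (M →ₗ[R] E)).flip = φ :=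
    TensorProduct.ext' fun l m => by simp [ψ]
  rw [← hψ, LinearMap.comp_apply, LinearMap.mem_ker.mp hx, map_zero]

/-- a GV-torsion-free module `M` is pure `w`-injective iff it is a
direct summand of a module of the form `Hom_R(L, Ehat)`. -/
theorem gvTorsionFree_pureWInjective_iff_summand
    {R : Type u} [CommRing R] [IsDomain R]
    (Ehat : Type u) [AddCommGroup Ehat] [Module R Ehat]
    (hE : IsWUniversalInjective R Ehat)
    (M : Type u) [AddCommGroup M] [Module R M]
    (hMtf : ∀ m : M, IsGVTorsionElem R m → m = 0) :
    IsPureWInjective R M ↔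
      ∃ (L : ModuleCat.{u} R) (i : M →ₗ[R] (L →ₗ[R] Ehat))
        (p : (L →ₗ[R] Ehat) →ₗ[R] M), p ∘ₗ i = LinearMap.id := by
  constructor
  · intro hM
    obtain ⟨h, hh⟩ := hM M ((M →ₗ[R] Ehat) →ₗ[R] Ehat) LinearMap.id.flip
      (fun x hx => hE.isGVTorsionElem fun f => LinearMap.congr_fun (LinearMap.mem_ker.mp hx) f)
      (fun L _ _ x hx => hE.lTensor_eval M L x hx) LinearMap.id
    exact ⟨ModuleCat.of R (M →ₗ[R] Ehat), _, h, hh⟩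
  · rintro ⟨L, i, p, hpi⟩
    exact (isPureWInjective_linearMap hE.1 hE.2.1 L).of_retract i p hpi
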